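/- Let a ≥ 1, b, c ≥ 0 be integers with b + c ≥ 1, and let V = Spec ℂ[x₁,…,x₅]/(x₁x₂ − x₄^c x₅^b, x₃x₄ − x₅^a). Then V is a complete intersection of dimension 3; in particular the ideal (x₁x₂ − x₄^c x₅^b, x₃x₄ − x₅^a) ⊂ ℂ[x₁,…,x₅] has height 2 and ℂ[x₁,…,x₅]/(x₁x₂ − x₄^c x₅^b, x₃x₄ − x₅^a) is a Cohen–Macaulay ring of Krull dimension 3. -/

import Mathlib

noncomputable section

open MvPolynomial

/-- The height of an ideal: the infimum of the heights of the primes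
containing it. -/
def idealHeight {R : Type*} [CommRing R] (I : Ideal R) : ℕ∞ :=
  ⨅ (P : PrimeSpectrum R) (_ : I ≤ P.asIdeal), Order.height P

/-- The ideal `(x₁x₂ − x₄^c x₅^b, x₃x₄ − x₅^a)` of `ℂ[x₁,…,x₅]`. -/
def Iabc (a b c : ℕ) : Ideal (MvPolynomial (Fin 5) ℂ) :=
  Ideal.span {X 0 * X 1 - X 3 ^ c * X 4 ^ b, X 2 * X 3 - X 4 ^ a}

open scoped Pointwise

lemma height_of_isMaximal_fin (n : ℕ) (M : Ideal (MvPolynomial (Fin n) ℂ)) [hM : M.IsMaximal] :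
    M.height = n := by
  induction n with
  | zero =>
    have h := Ideal.height_le_ringKrullDim_of_ne_top hM.ne_top
    rw [MvPolynomial.ringKrullDim_of_isNoetherianRing, ringKrullDim_eq_zero_of_field] at h
    have h' : M.height ≤ 0 := by
      rw [← WithBot.coe_le_coe]; simpa using h
    simpa using h'
  | succ n ih =>
    let e := (finSuccEquiv ℂ n).toRingEquiv
    let P : Ideal (Polynomial (MvPolynomial (Fin n) ℂ)) := M.comap e.symm
    have hP : P.IsMaximal := Ideal.comap_isMaximal_of_equiv e.symm
    have h1 : P.height = M.height := e.symm.height_comap M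
    let p : Ideal (MvPolynomial (Fin n) ℂ) := P.comap Polynomial.C
    have hp : p.IsMaximal := Polynomial.isMaximal_comap_C_of_isJacobsonRing P
    have : P.LiesOver p := ⟨rfl⟩
    rw [← h1, Polynomial.height_eq_height_add_one p P, ih p]
    simp

lemma ncard_pair_le_two {R : Type*} (f g : R) : ({f, g} : Set R).ncard ≤ 2 := by
  refine (Set.ncard_insert_le f {g}).trans ?_
  simp

lemma prime_first (b c : ℕ) :
    Prime (X 0 * X 1 - X 3 ^ c * X 4 ^ b : MvPolynomial (Fin 5) ℂ) := by
  have h : Irreducible ((X 1 : MvPolynomial (Fin 5) ℂ) * X 0 + -(X 3 ^ c * X 4 ^ b)) := by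
    apply irreducible_mul_X_add
    · exact X_ne_zero _
    · simp [vars_X]
    · rw [vars_neg]
      intro h
      have h := vars_mul _ _ h
      rw [Finset.mem_union] at h
      rcases h with h | h <;> simpa [vars_X] using vars_pow _ _ h
    · rw [IsRelPrime.neg_right_iff]
      refine ((X_prime (R := ℂ) (i := (1 : Fin 5))).irreducible.isRelPrime_iff_not_dvd).2 ?_
      rintro ⟨q, hq⟩
      have := congrArg (eval (fun i : Fin 5 => if i = 1 then (0 : ℂ) else 1)) hq
      simp at this
  have e : (X 0 * X 1 - X 3 ^ c * X 4 ^ b : MvPolynomial (Fin 5) ℂ) =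
      (X 1 : MvPolynomial (Fin 5) ℂ) * X 0 + -(X 3 ^ c * X 4 ^ b) := by ring
  rw [e]
  exact h.prime

lemma second_notMem (a b c : ℕ) (ha : 1 ≤ a) :
    (X 2 * X 3 - X 4 ^ a : MvPolynomial (Fin 5) ℂ) ∉
      Ideal.span {(X 0 * X 1 - X 3 ^ c * X 4 ^ b : MvPolynomial (Fin 5) ℂ)} := by
  rw [Ideal.mem_span_singleton]
  rintro ⟨q, hq⟩
  -- evaluate at the point (1, 1, 2, 1, 1)
  have := congrArg (eval (![1, 1, 2, 1, 1] : Fin 5 → ℂ)) hq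
  simp only [map_sub, map_mul, map_pow, eval_X, Matrix.cons_val] at this
  norm_num at this

lemma Iabc_le_origin (a b c : ℕ) (ha : 1 ≤ a) (hbc : 1 ≤ b + c) :
    Iabc a b c ≤ RingHom.ker (eval (0 : Fin 5 → ℂ)) := by
  rw [Iabc, Ideal.span_le]
  rintro x (rfl | rfl)
  · have : (0 : ℂ) ^ c * 0 ^ b = 0 := by
      rw [← pow_add]; exact zero_pow (by omega)
    simp [RingHom.mem_ker, -mul_eq_zero, this]
  · have : a ≠ 0 := by omega
    simp [RingHom.mem_ker, this]

/-- `V = Spec ℂ[x₁,…,x₅]/(x₁x₂ − x₄^c x₅^b, x₃x₄ − x₅^a)` with `a ≥ 1`,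
`b + c ≥ 1` is a complete intersection of dimension 3: the two equations form
a regular sequence, the ideal they generate has height 2, and the quotient
ring has Krull dimension 3. -/
theorem lci_toric_threefold (a b c : ℕ) (ha : 1 ≤ a) (hbc : 1 ≤ b + c) :
    RingTheory.Sequence.IsRegular (R := MvPolynomial (Fin 5) ℂ) (MvPolynomial (Fin 5) ℂ)
      [X 0 * X 1 - X 3 ^ c * X 4 ^ b, X 2 * X 3 - X 4 ^ a] ∧
    idealHeight (Iabc a b c) = 2 ∧
    ringKrullDim (MvPolynomial (Fin 5) ℂ ⧸ Iabc a b c) = 3 := by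
  set f : MvPolynomial (Fin 5) ℂ := X 0 * X 1 - X 3 ^ c * X 4 ^ b with hf
  set g : MvPolynomial (Fin 5) ℂ := X 2 * X 3 - X 4 ^ a with hg
  have hfp : Prime f := prime_first b c
  have hgn : g ∉ Ideal.span {f} := second_notMem a b c ha
  have hI : Iabc a b c = Ideal.span {f, g} := rfl
  have hle := Iabc_le_origin a b c ha hbc
  have hmax : (RingHom.ker (eval (0 : Fin 5 → ℂ))).IsMaximal :=
    RingHom.ker_isMaximal_of_surjective _ (fun z => ⟨C z, by simp⟩)
  have hne : Iabc a b c ≠ ⊤ := fun h => hmax.ne_top (top_le_iff.1 (h ▸ hle))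
  have hspan : (Ideal.span {f}).IsPrime := (Ideal.span_singleton_prime hfp.ne_zero).2 hfp
  refine ⟨?_, ?_, ?_⟩
  · refine ⟨.cons ?_ ?_, ?_⟩
    · intro x y hxy
      exact mul_left_cancel₀ hfp.ne_zero hxy
    · rw [RingTheory.Sequence.isWeaklyRegular_singleton_iff]
      rw [isSMulRegular_iff_right_eq_zero_of_smul]
      intro x hx
      obtain ⟨x, rfl⟩ := Submodule.Quotient.mk_surjective _ x
      rw [← Submodule.Quotient.mk_smul, Submodule.Quotient.mk_eq_zero] at hx
      rw [Submodule.Quotient.mk_eq_zero]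
      have e : (f • (⊤ : Submodule (MvPolynomial (Fin 5) ℂ) (MvPolynomial (Fin 5) ℂ)))
          = Ideal.span {f} := by
        rw [← Submodule.ideal_span_singleton_smul]; simp
      rw [e] at hx ⊢
      exact (hspan.mem_or_mem hx).resolve_left hgn
    · have : Ideal.ofList [f, g] = Iabc a b c := by
        rw [hI, Ideal.ofList]; congr 1; ext; simp
      rw [this]
      simpa using hne.symm
  · apply le_antisymm
    · obtain ⟨p, hp⟩ := Ideal.nonempty_minimalPrimes hne
      have := hp.isPrime
      refine (iInf₂_le (⟨p, this⟩ : PrimeSpectrum _) hp.1.2).trans ?_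
      rw [← PrimeSpectrum.height_eq_orderHeight]
      refine (Ideal.height_le_card_of_mem_minimalPrimes_span (s := {f, g}) (by simp) hp).trans ?_
      exact_mod_cast ncard_pair_le_two f g
    · refine le_iInf₂ fun P hP => ?_
      have h1 : (⟨⊥, Ideal.isPrime_bot⟩ : PrimeSpectrum (MvPolynomial (Fin 5) ℂ)) <
          ⟨Ideal.span {f}, hspan⟩ := by
        change (⊥ : Ideal (MvPolynomial (Fin 5) ℂ)) < Ideal.span {f}
        rw [bot_lt_iff_ne_bot]
        simpa using hfp.ne_zero
      have h2 : (⟨Ideal.span {f}, hspan⟩ : PrimeSpectrum (MvPolynomial (Fin 5) ℂ)) < P := by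
        change Ideal.span {f} < P.asIdeal
        refine lt_of_le_of_ne ?_ ?_
        · exact (Ideal.span_mono (by simp [f])).trans hP
        · intro h
          exact hgn (h ▸ hP (Ideal.subset_span (by simp [g])))
      have h3 := Order.height_add_one_le h1
      have h4 := Order.height_add_one_le h2
      calc (2 : ℕ∞) = 0 + 1 + 1 := by norm_num
        _ ≤ _ := by
          refine le_trans ?_ h4
          gcongr
          refine le_trans ?_ h3
          gcongr
          exact zero_le
  · have hdim : ringKrullDim (MvPolynomial (Fin 5) ℂ) = 5 := by
      rw [MvPolynomial.ringKrullDim_of_isNoetherianRing, ringKrullDim_eq_zero_of_field]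
      simp
    have hlow : (5 : WithBot ℕ∞) ≤ ringKrullDim (MvPolynomial (Fin 5) ℂ ⧸ Iabc a b c) + 2 := by
      have h := height_le_ringKrullDim_quotient_add_spanFinrank hle
      rw [height_of_isMaximal_fin] at h
      refine le_trans (by exact_mod_cast h) ?_
      gcongr
      have : (Iabc a b c).spanFinrank ≤ 2 :=
        (Submodule.spanFinrank_span_le_ncard_of_finite (by simp)).trans (ncard_pair_le_two f g)
      exact_mod_cast this
    have h1 := ringKrullDim_quotient_succ_le_of_nonZeroDivisor
      (mem_nonZeroDivisors_of_ne_zero hfp.ne_zero)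
    have hfI : Ideal.span {f} ≤ Iabc a b c := Ideal.span_mono (by simp [f])
    have h2 := ringKrullDim_succ_le_of_surjective (Ideal.Quotient.factor hfI)
      (Ideal.Quotient.factor_surjective hfI) (r := Ideal.Quotient.mk _ g)
      (mem_nonZeroDivisors_of_ne_zero (by rwa [Ne, Ideal.Quotient.eq_zero_iff_mem]))
      (by
        rw [Ideal.Quotient.factor_mk, Ideal.Quotient.eq_zero_iff_mem]
        exact Ideal.subset_span (by simp [g]))
    have hup : ringKrullDim (MvPolynomial (Fin 5) ℂ ⧸ Iabc a b c) + 1 + 1 ≤ 5 := by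
      rw [← hdim]
      exact le_trans (by gcongr) h1
    generalize ringKrullDim (MvPolynomial (Fin 5) ℂ ⧸ Iabc a b c) = d at hlow hup
    induction d with
    | bot => simp at hlow
    | coe d =>
      induction d with
      | top => exact absurd hup (by decide)
      | coe d =>
        have hlow' : ((5 : ℕ) : ℕ∞) ≤ ((d + 2 : ℕ) : ℕ∞) := WithBot.coe_le_coe.1 hlow
        have hup' : ((d + 1 + 1 : ℕ) : ℕ∞) ≤ ((5 : ℕ) : ℕ∞) := WithBot.coe_le_coe.1 hup
        rw [Nat.cast_le] at hlow' hup'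
        obtain rfl : d = 3 := by omega
        rfl
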